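/- (Theorem 4.7) In every phase model for LG∅^pol: if the polarized presentation Γ,Δ ⊢ is derivable then ⟦↓Γ⁻⟧⁺ ⊆ ⟦Δ⁺⟧⁺; and if the stoup judgment Γ ⊢ P is derivable then ⟦P⟧⁺ ⊆ ⟦Γ⁺⟧⁺. -/

import Mathlib

mutual
/-- Positive polarized formulas.  `rsub P N` denotes `P⊘N`, `lsub N P` denotes `N⦸P`. -/
inductive PFm : Type
  | pos : Nat → PFm               -- atom p
  | tens : PFm → PFm → PFm        -- P ⊗ Q
  | rsub : PFm → NFm → PFm        -- P ⊘ N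
  | lsub : NFm → PFm → PFm        -- N ⦸ P
  | disj : PFm → PFm → PFm        -- P ∨ Q
  | down : NFm → PFm              -- ↓N
/-- Negative polarized formulas.  `rdiv M Q` denotes `M/Q`, `ldiv Q M` denotes `Q\M`. -/
inductive NFm : Type
  | neg : Nat → NFm               -- atom p̄
  | par : NFm → NFm → NFm         -- M ⊕ N
  | ldiv : PFm → NFm → NFm        -- Q \ M
  | rdiv : NFm → PFm → NFm        -- M / Q
  | conj : NFm → NFm → NFm        -- M ∧ N
  | up : PFm → NFm                -- ↑P
end

mutual
/-- Polarized linear negation (positive to negative). -/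
def PFm.dual : PFm → NFm
  | .pos n => .neg n
  | .tens P Q => .par Q.dual P.dual        -- (P⊗Q)⊥ = Q⊥⊕P⊥
  | .rsub P N => .ldiv N.dual P.dual       -- (P⊘N)⊥ = N⊥\P⊥
  | .lsub N P => .rdiv P.dual N.dual       -- (N⦸P)⊥ = P⊥/N⊥
  | .disj P Q => .conj Q.dual P.dual       -- (P∨Q)⊥ = Q⊥∧P⊥
  | .down N => .up N.dual                  -- (↓N)⊥ = ↑(N⊥)
/-- Polarized linear negation (negative to positive). -/
def NFm.dual : NFm → PFm
  | .neg n => .pos n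
  | .par M N => .tens N.dual M.dual        -- (M⊕N)⊥ = N⊥⊗M⊥
  | .ldiv Q M => .rsub M.dual Q.dual       -- (Q\M)⊥ = M⊥⊘Q⊥
  | .rdiv M Q => .lsub Q.dual M.dual       -- (M/Q)⊥ = Q⊥⦸M⊥
  | .conj M N => .disj N.dual M.dual       -- (M∧N)⊥ = N⊥∨M⊥
  | .up P => .down P.dual                  -- (↑P)⊥ = ↓(P⊥)
end
/-- Polarized structures, containing only positive formulas.
`slsub Δ Γ` denotes `Δ·⦸·Γ`, `srsub Γ Δ` denotes `Γ·⊘·Δ`. -/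
inductive PStr : Type
  | fm : PFm → PStr
  | stens : PStr → PStr → PStr
  | srsub : PStr → PStr → PStr
  | slsub : PStr → PStr → PStr

mutual
/-- The positive formula interpretation Γ⁺ of a polarized structure. -/
def PStr.posF : PStr → PFm
  | .fm P => P
  | .stens Γ Δ => .tens Γ.posF Δ.posF
  | .srsub Γ Δ => .rsub Γ.posF Δ.negF
  | .slsub Δ Γ => .lsub Δ.negF Γ.posF
/-- The negative formula interpretation Γ⁻ of a polarized structure. -/
def PStr.negF : PStr → NFm
  | .fm P => P.dual
  | .stens Γ Δ => .par Δ.negF Γ.negF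
  | .srsub Γ Δ => .ldiv Δ.posF Γ.negF
  | .slsub Δ Γ => .rdiv Γ.negF Δ.posF
end
mutual
/-- The polarized sequent calculus LG∅^pol: presentation judgement `Γ,Δ ⊢`. -/
inductive PSeq : PStr → PStr → Prop
  | cut {Γ Δ P} : PStoup Δ P → PSeq Γ (.fm P) → PSeq Γ Δ
  | downL {Γ N} : PStoup Γ N.dual → PSeq Γ (.fm (.down N))
  | tensL {Γ P Q} : PSeq Γ (.stens (.fm P) (.fm Q)) → PSeq Γ (.fm (.tens P Q))
  | lsubL {Γ N P} : PSeq Γ (.slsub (.fm N.dual) (.fm P)) → PSeq Γ (.fm (.lsub N P))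
  | rsubL {Γ P N} : PSeq Γ (.srsub (.fm P) (.fm N.dual)) → PSeq Γ (.fm (.rsub P N))
  | disjL {Γ P Q} : PSeq Γ (.fm P) → PSeq Γ (.fm Q) → PSeq Γ (.fm (.disj P Q))
  | sym {Γ Δ} : PSeq Γ Δ → PSeq Δ Γ
  | dp1 {Γ Δ Θ} : PSeq (.stens Γ Δ) Θ → PSeq Γ (.slsub Δ Θ)
  | dp1' {Γ Δ Θ} : PSeq Γ (.slsub Δ Θ) → PSeq (.stens Γ Δ) Θ
  | dp2 {Γ Δ Θ} : PSeq Γ (.stens Δ Θ) → PSeq (.srsub Γ Δ) Θ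
  | dp2' {Γ Δ Θ} : PSeq (.srsub Γ Δ) Θ → PSeq Γ (.stens Δ Θ)
/-- The polarized sequent calculus LG∅^pol: stoup judgement `Γ ⊢ P`. -/
inductive PStoup : PStr → PFm → Prop
  | id {P} : PStoup (.fm P) P
  | downR {Γ N} : PSeq Γ (.fm N.dual) → PStoup Γ (.down N)
  | tensR {Γ Δ P Q} : PStoup Γ P → PStoup Δ Q → PStoup (.stens Γ Δ) (.tens P Q)
  | lsubR {Γ Δ N P} : PStoup Δ N.dual → PStoup Γ P → PStoup (.slsub Δ Γ) (.lsub N P)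
  | rsubR {Γ Δ N P} : PStoup Δ N.dual → PStoup Γ P → PStoup (.srsub Γ Δ) (.rsub P N)
  | disjRl {Γ P Q} : PStoup Γ P → PStoup Γ (.disj P Q)
  | disjRr {Γ P Q} : PStoup Γ Q → PStoup Γ (.disj P Q)
end
/-- A phase space: a nonempty set of phases with operations ·⊗·, ·⊘·, ·⦸· and a
relation ⊥ satisfying symmetry and the display conditions. -/
structure PhaseSpace where
  W : Type
  nonempty : Nonempty W
  ptens : W → W → W
  prsub : W → W → W        -- x·⊘·y
  plsub : W → W → W        -- x·⦸·y
  bot : W → W → Prop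
  bot_symm : ∀ {x y}, bot x y → bot y x
  bot_disp1 : ∀ x y z, bot (ptens x y) z ↔ bot x (plsub y z)
  bot_disp2 : ∀ x y z, bot x (ptens y z) ↔ bot (prsub x y) z

/-- The polar A^⊥ of a subset of a phase space. -/
def PhaseSpace.pol (S : PhaseSpace) (A : Set S.W) : Set S.W := {x | ∀ y ∈ A, S.bot x y}

/-- A×B = {x·⊗·y | x∈A^⊥, y∈B^⊥}^⊥. -/
def PhaseSpace.times (S : PhaseSpace) (A B : Set S.W) : Set S.W :=
  S.pol {z | ∃ x ∈ S.pol A, ∃ y ∈ S.pol B, z = S.ptens x y}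
/-- A←B = {x·⊘·y | x∈A^⊥, y∈B^⊥}^⊥. -/
def PhaseSpace.larr (S : PhaseSpace) (A B : Set S.W) : Set S.W :=
  S.pol {z | ∃ x ∈ S.pol A, ∃ y ∈ S.pol B, z = S.prsub x y}
/-- A→B = {x·⦸·y | x∈A^⊥, y∈B^⊥}^⊥. -/
def PhaseSpace.rarr (S : PhaseSpace) (A B : Set S.W) : Set S.W :=
  S.pol {z | ∃ x ∈ S.pol A, ∃ y ∈ S.pol B, z = S.plsub x y}

/-- A phase model: a phase space with a valuation of the positive atoms by facts. -/
structure PhaseModel extends PhaseSpace where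
  v : Nat → Set toPhaseSpace.W
  v_fact : ∀ n, toPhaseSpace.pol (toPhaseSpace.pol (v n)) = v n

mutual
/-- The interpretation ⟦P⟧⁺ of a positive polarized formula in a phase model. -/
def PhaseModel.ipos (Mo : PhaseModel) : PFm → Set Mo.W
  | .pos n => Mo.v n
  | .tens P Q => Mo.toPhaseSpace.times (Mo.ipos P) (Mo.ipos Q)
  | .rsub P N => Mo.toPhaseSpace.larr (Mo.ipos P) (Mo.ineg N)
  | .lsub N P => Mo.toPhaseSpace.rarr (Mo.ineg N) (Mo.ipos P)
  | .disj P Q => Mo.ipos P ∩ Mo.ipos Q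
  | .down N => Mo.toPhaseSpace.pol (Mo.ineg N)
/-- The interpretation ⟦N⟧⁻ of a negative polarized formula in a phase model. -/
def PhaseModel.ineg (Mo : PhaseModel) : NFm → Set Mo.W
  | .neg n => Mo.v n
  | .par M N => Mo.toPhaseSpace.times (Mo.ineg N) (Mo.ineg M)
  | .rdiv M Q => Mo.toPhaseSpace.rarr (Mo.ipos Q) (Mo.ineg M)
  | .ldiv Q M => Mo.toPhaseSpace.larr (Mo.ineg M) (Mo.ipos Q)
  | .conj M N => Mo.ineg M ∩ Mo.ineg N
  | .up P => Mo.toPhaseSpace.pol (Mo.ipos P)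
end

namespace PhaseSpace
variable (S : PhaseSpace)

theorem pol_anti {A B : Set S.W} (h : A ⊆ B) : S.pol B ⊆ S.pol A :=
  fun _ hx y hy => hx y (h hy)

theorem sub_pol_pol (A : Set S.W) : A ⊆ S.pol (S.pol A) :=
  fun x hx _ hy => S.bot_symm (hy x hx)

theorem pol_fact (A : Set S.W) : S.pol (S.pol (S.pol A)) = S.pol A :=
  Set.Subset.antisymm (S.pol_anti (S.sub_pol_pol A)) (S.sub_pol_pol _)

theorem inter_fact {A B : Set S.W} (hA : S.pol (S.pol A) = A) (hB : S.pol (S.pol B) = B) :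
    S.pol (S.pol (A ∩ B)) = A ∩ B := by
  refine Set.Subset.antisymm (fun x hx => ⟨?_, ?_⟩) (S.sub_pol_pol _)
  · rw [← hA]; exact S.pol_anti (S.pol_anti Set.inter_subset_left) hx
  · rw [← hB]; exact S.pol_anti (S.pol_anti Set.inter_subset_right) hx

theorem times_mono {A B A' B' : Set S.W} (h : A ⊆ A') (k : B ⊆ B') :
    S.times A B ⊆ S.times A' B' := by
  apply S.pol_anti
  rintro z ⟨x, hx, y, hy, e⟩
  exact ⟨x, S.pol_anti h hx, y, S.pol_anti k hy, e⟩

theorem larr_mono {A B A' B' : Set S.W} (h : A ⊆ A') (k : B ⊆ B') :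
    S.larr A B ⊆ S.larr A' B' := by
  apply S.pol_anti
  rintro z ⟨x, hx, y, hy, e⟩
  exact ⟨x, S.pol_anti h hx, y, S.pol_anti k hy, e⟩

theorem rarr_mono {A B A' B' : Set S.W} (h : A ⊆ A') (k : B ⊆ B') :
    S.rarr A B ⊆ S.rarr A' B' := by
  apply S.pol_anti
  rintro z ⟨x, hx, y, hy, e⟩
  exact ⟨x, S.pol_anti h hx, y, S.pol_anti k hy, e⟩

theorem symm_sub {A B : Set S.W} (hA : S.pol (S.pol A) = A) (h : S.pol A ⊆ B) :
    S.pol B ⊆ A := by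
  have := S.pol_anti h
  rwa [hA] at this

theorem sub_polar_left {T B : Set S.W} (hB : S.pol (S.pol B) = B) :
    S.pol (S.pol T) ⊆ B ↔ ∀ s ∈ T, ∀ z ∈ S.pol B, S.bot s z := by
  constructor
  · intro h s hs z hz
    exact S.bot_symm (hz s (h (S.sub_pol_pol T hs)))
  · intro h
    rw [← hB]
    exact S.pol_anti (fun z hz s hs => S.bot_symm (h s hs z hz))

theorem sub_times_left (A B C : Set S.W) (hC : S.pol (S.pol C) = C) :
    S.pol (S.times A B) ⊆ C ↔
      ∀ x ∈ S.pol A, ∀ y ∈ S.pol B, ∀ z ∈ S.pol C, S.bot (S.ptens x y) z := by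
  unfold times
  rw [S.sub_polar_left hC]
  constructor
  · intro h x hx y hy
    exact h _ ⟨x, hx, y, hy, rfl⟩
  · rintro h _ ⟨x, hx, y, hy, rfl⟩
    exact h x hx y hy

theorem sub_larr_left (A B C : Set S.W) (hC : S.pol (S.pol C) = C) :
    S.pol (S.larr A B) ⊆ C ↔
      ∀ x ∈ S.pol A, ∀ y ∈ S.pol B, ∀ z ∈ S.pol C, S.bot (S.prsub x y) z := by
  unfold larr
  rw [S.sub_polar_left hC]
  constructor
  · intro h x hx y hy
    exact h _ ⟨x, hx, y, hy, rfl⟩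
  · rintro h _ ⟨x, hx, y, hy, rfl⟩
    exact h x hx y hy

theorem sub_times_right (A B C : Set S.W) :
    S.pol A ⊆ S.times B C ↔
      ∀ x ∈ S.pol A, ∀ y ∈ S.pol B, ∀ z ∈ S.pol C, S.bot x (S.ptens y z) := by
  constructor
  · intro h x hx y hy z hz
    exact h hx _ ⟨y, hy, z, hz, rfl⟩
  · rintro h x hx _ ⟨y, hy, z, hz, rfl⟩
    exact h x hx y hy z hz

theorem sub_rarr_right (A B C : Set S.W) :
    S.pol A ⊆ S.rarr B C ↔
      ∀ x ∈ S.pol A, ∀ y ∈ S.pol B, ∀ z ∈ S.pol C, S.bot x (S.plsub y z) := by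
  constructor
  · intro h x hx y hy z hz
    exact h hx _ ⟨y, hy, z, hz, rfl⟩
  · rintro h x hx _ ⟨y, hy, z, hz, rfl⟩
    exact h x hx y hy z hz

theorem disp1 (A B C : Set S.W) (hC : S.pol (S.pol C) = C) :
    S.pol (S.times A B) ⊆ C ↔ S.pol A ⊆ S.rarr B C := by
  rw [S.sub_times_left _ _ _ hC, S.sub_rarr_right]
  simp only [S.bot_disp1]

theorem disp2 (A B C : Set S.W) (hC : S.pol (S.pol C) = C) :
    S.pol A ⊆ S.times B C ↔ S.pol (S.larr A B) ⊆ C := by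
  rw [S.sub_larr_left _ _ _ hC, S.sub_times_right]
  simp only [S.bot_disp2]

end PhaseSpace

namespace PhaseModel

mutual
theorem ineg_dual (Mo : PhaseModel) : ∀ P : PFm, Mo.ineg P.dual = Mo.ipos P
  | .pos n => by simp only [PFm.dual, ineg, ipos]
  | .tens P Q => by simp only [PFm.dual, ineg, ipos, ineg_dual Mo P, ineg_dual Mo Q]
  | .rsub P N => by simp only [PFm.dual, ineg, ipos, ineg_dual Mo P, ipos_dual Mo N]
  | .lsub N P => by simp only [PFm.dual, ineg, ipos, ineg_dual Mo P, ipos_dual Mo N]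
  | .disj P Q => by
      simp only [PFm.dual, ineg, ipos, ineg_dual Mo P, ineg_dual Mo Q, Set.inter_comm]
  | .down N => by simp only [PFm.dual, ineg, ipos, ipos_dual Mo N]
theorem ipos_dual (Mo : PhaseModel) : ∀ N : NFm, Mo.ipos N.dual = Mo.ineg N
  | .neg n => by simp only [NFm.dual, ineg, ipos]
  | .par M N => by simp only [NFm.dual, ineg, ipos, ipos_dual Mo M, ipos_dual Mo N]
  | .ldiv Q M => by simp only [NFm.dual, ineg, ipos, ipos_dual Mo M, ineg_dual Mo Q]
  | .rdiv M Q => by simp only [NFm.dual, ineg, ipos, ipos_dual Mo M, ineg_dual Mo Q]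
  | .conj M N => by
      simp only [NFm.dual, ineg, ipos, ipos_dual Mo M, ipos_dual Mo N, Set.inter_comm]
  | .up P => by simp only [NFm.dual, ineg, ipos, ineg_dual Mo P]
end

theorem ipos_fact (Mo : PhaseModel) : ∀ P : PFm,
    Mo.toPhaseSpace.pol (Mo.toPhaseSpace.pol (Mo.ipos P)) = Mo.ipos P
  | .pos n => by simp only [ipos, Mo.v_fact]
  | .tens P Q => by simp only [ipos]; exact Mo.toPhaseSpace.pol_fact _
  | .rsub P N => by simp only [ipos]; exact Mo.toPhaseSpace.pol_fact _
  | .lsub N P => by simp only [ipos]; exact Mo.toPhaseSpace.pol_fact _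
  | .disj P Q => by
      simp only [ipos]
      exact Mo.toPhaseSpace.inter_fact (ipos_fact Mo P) (ipos_fact Mo Q)
  | .down N => by simp only [ipos]; exact Mo.toPhaseSpace.pol_fact _

theorem ineg_negF (Mo : PhaseModel) (Γ : PStr) : Mo.ineg Γ.negF = Mo.ipos Γ.posF := by
  induction Γ with
  | fm P => simp only [PStr.negF, PStr.posF, ineg_dual]
  | stens Γ Δ h k => simp only [PStr.negF, PStr.posF, ineg, ipos, h, k]
  | srsub Γ Δ h k => simp only [PStr.negF, PStr.posF, ineg, ipos, h, k]
  | slsub Γ Δ h k => simp only [PStr.negF, PStr.posF, ineg, ipos, h, k]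

mutual
theorem sound_seq (Mo : PhaseModel) : ∀ {Γ Δ : PStr}, PSeq Γ Δ →
    Mo.toPhaseSpace.pol (Mo.ipos Γ.posF) ⊆ Mo.ipos Δ.posF
  | _, _, .cut h k => (sound_seq Mo k).trans (sound_stoup Mo h)
  | _, _, .downL h => by
      have := sound_stoup Mo h
      rw [ipos_dual] at this
      simp only [PStr.posF, ipos]
      exact Mo.toPhaseSpace.pol_anti this
  | _, _, .tensL h => by
      have := sound_seq Mo h
      simpa only [PStr.posF, ipos] using this
  | _, _, .lsubL h => by
      have := sound_seq Mo h
      simpa only [PStr.posF, PStr.negF, ipos, ineg_dual, ipos_dual] using this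
  | _, _, .rsubL h => by
      have := sound_seq Mo h
      simpa only [PStr.posF, PStr.negF, ipos, ineg_dual, ipos_dual] using this
  | _, _, .disjL h k => by
      have h1 := sound_seq Mo h
      have h2 := sound_seq Mo k
      simp only [PStr.posF, ipos] at h1 h2 ⊢
      exact Set.subset_inter h1 h2
  | _, _, .sym h => Mo.toPhaseSpace.symm_sub (Mo.ipos_fact _) (sound_seq Mo h)
  | _, _, .dp1 h => by
      have := sound_seq Mo h
      simp only [PStr.posF, ipos, ineg_negF] at this ⊢
      exact (Mo.toPhaseSpace.disp1 _ _ _ (Mo.ipos_fact _)).1 this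
  | _, _, .dp1' h => by
      have := sound_seq Mo h
      simp only [PStr.posF, ipos, ineg_negF] at this ⊢
      exact (Mo.toPhaseSpace.disp1 _ _ _ (Mo.ipos_fact _)).2 this
  | _, _, .dp2 h => by
      have := sound_seq Mo h
      simp only [PStr.posF, ipos, ineg_negF] at this ⊢
      exact (Mo.toPhaseSpace.disp2 _ _ _ (Mo.ipos_fact _)).1 this
  | _, _, .dp2' h => by
      have := sound_seq Mo h
      simp only [PStr.posF, ipos, ineg_negF] at this ⊢
      exact (Mo.toPhaseSpace.disp2 _ _ _ (Mo.ipos_fact _)).2 this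
theorem sound_stoup (Mo : PhaseModel) : ∀ {Γ : PStr} {P : PFm}, PStoup Γ P →
    Mo.ipos P ⊆ Mo.ipos Γ.posF
  | _, _, .id => by simp only [PStr.posF]; exact Set.Subset.rfl
  | _, _, .downR h => by
      have := sound_seq Mo h
      simp only [PStr.posF, ipos, ipos_dual] at this ⊢
      exact Mo.toPhaseSpace.symm_sub (Mo.ipos_fact _) this
  | _, _, .tensR h k => by
      simp only [PStr.posF, ipos]
      exact Mo.toPhaseSpace.times_mono (sound_stoup Mo h) (sound_stoup Mo k)
  | _, _, .lsubR h k => by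
      have h1 := sound_stoup Mo h
      rw [ipos_dual] at h1
      simp only [PStr.posF, ipos, ineg_negF]
      exact Mo.toPhaseSpace.rarr_mono h1 (sound_stoup Mo k)
  | _, _, .rsubR h k => by
      have h1 := sound_stoup Mo h
      rw [ipos_dual] at h1
      simp only [PStr.posF, ipos, ineg_negF]
      exact Mo.toPhaseSpace.larr_mono (sound_stoup Mo k) h1
  | _, _, .disjRl h => by
      simp only [ipos]
      exact Set.inter_subset_left.trans (sound_stoup Mo h)
  | _, _, .disjRr h => by
      simp only [ipos]
      exact Set.inter_subset_right.trans (sound_stoup Mo h)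
end

end PhaseModel

/-- Theorem 4.7, soundness: in every phase model for LG∅^pol, if the
polarized presentation `Γ,Δ ⊢` is derivable then ⟦↓Γ⁻⟧⁺ ⊆ ⟦Δ⁺⟧⁺, and if the stoup
judgment `Γ ⊢ P` is derivable then ⟦P⟧⁺ ⊆ ⟦Γ⁺⟧⁺. -/
theorem phase_soundness (Mo : PhaseModel) :
    (∀ Γ Δ : PStr, PSeq Γ Δ → Mo.ipos (.down Γ.negF) ⊆ Mo.ipos Δ.posF) ∧
    (∀ (Γ : PStr) (P : PFm), PStoup Γ P → Mo.ipos P ⊆ Mo.ipos Γ.posF) := by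
  refine ⟨fun Γ Δ h => ?_, fun Γ P h => Mo.sound_stoup h⟩
  have := Mo.sound_seq h
  simpa only [PhaseModel.ipos, PhaseModel.ineg_negF] using this
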